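/- Let X and Y be real Banach spaces, let 𝒦₁ : Y → X be a bounded linear operator, K₂ : X × X → Y a continuous bilinear map, and φ ∈ Y. Define the fast iterates η̃⁽⁰⁾ = 0, η̃⁽¹⁾ = 𝒦₁φ, and η̃⁽ⁿ⁺¹⁾ = η̃⁽ⁿ⁾ − 𝒦₁(K₂(η̃⁽ⁿ⁾ − η̃⁽ⁿ⁻¹⁾, η̃⁽¹⁾)) for n ≥ 1; and define the sequence η̂₁ = 𝒦₁φ and η̂_j = −𝒦₁(K₂(η̂_{j−1}, η̂₁)) for j ≥ 2. Then for every n ≥ 1 one has the exact identity η̃⁽ⁿ⁾ = Σ_{j=1}^n η̂_j. -/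

import Mathlib

/-- The fast iterative scheme: `η̃⁽⁰⁾ = 0`, `η̃⁽¹⁾ = 𝒦₁φ`, and
`η̃⁽ⁿ⁺¹⁾ = η̃⁽ⁿ⁾ - 𝒦₁(K₂(η̃⁽ⁿ⁾ - η̃⁽ⁿ⁻¹⁾, η̃⁽¹⁾))` for `n ≥ 1`. -/
noncomputable def fastIter {X Y : Type*} [NormedAddCommGroup X] [NormedSpace ℝ X]
    [NormedAddCommGroup Y] [NormedSpace ℝ Y]
    (𝒦₁ : Y →L[ℝ] X) (K₂ : X →L[ℝ] X →L[ℝ] Y) (φ : Y) : ℕ → X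
  | 0 => 0
  | 1 => 𝒦₁ φ
  | n + 2 => fastIter 𝒦₁ K₂ φ (n + 1) -
      𝒦₁ (K₂ (fastIter 𝒦₁ K₂ φ (n + 1) - fastIter 𝒦₁ K₂ φ n) (𝒦₁ φ))

/-- The terms of the second reduced inverse Born series (index shift
`hatEta j = η̂_{j+1}`): `η̂₁ = 𝒦₁φ` and `η̂_j = -𝒦₁(K₂(η̂_{j-1}, η̂₁))` for `j ≥ 2`. -/
noncomputable def hatEta {X Y : Type*} [NormedAddCommGroup X] [NormedSpace ℝ X]
    [NormedAddCommGroup Y] [NormedSpace ℝ Y]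
    (𝒦₁ : Y →L[ℝ] X) (K₂ : X →L[ℝ] X →L[ℝ] Y) (φ : Y) : ℕ → X
  | 0 => 𝒦₁ φ
  | j + 1 => -𝒦₁ (K₂ (hatEta 𝒦₁ K₂ φ j) (𝒦₁ φ))

theorem fastIter_succ_sub {X Y : Type*} [NormedAddCommGroup X] [NormedSpace ℝ X]
    [NormedAddCommGroup Y] [NormedSpace ℝ Y]
    (𝒦₁ : Y →L[ℝ] X) (K₂ : X →L[ℝ] X →L[ℝ] Y) (φ : Y) (n : ℕ) :
    fastIter 𝒦₁ K₂ φ (n + 1) - fastIter 𝒦₁ K₂ φ n = hatEta 𝒦₁ K₂ φ n := by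
  induction n with
  | zero => simp [fastIter, hatEta]
  | succ n ih => rw [fastIter, hatEta, ih, sub_sub_cancel_left]

/-- **Section 7: the fast iterative scheme is exactly the second reduced inverse Born
series.**  For every `n ≥ 1`, the `n`-th fast iterate equals the `n`-th partial sum of
the series `Σ_j η̂_j`: `η̃⁽ⁿ⁾ = Σ_{j=1}^n η̂_j`. -/
theorem stmt_11 {X Y : Type*} [NormedAddCommGroup X] [NormedSpace ℝ X] [CompleteSpace X]
    [NormedAddCommGroup Y] [NormedSpace ℝ Y] [CompleteSpace Y]
    (𝒦₁ : Y →L[ℝ] X) (K₂ : X →L[ℝ] X →L[ℝ] Y) (φ : Y) :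
    ∀ n : ℕ, 1 ≤ n →
      fastIter 𝒦₁ K₂ φ n = ∑ j ∈ Finset.range n, hatEta 𝒦₁ K₂ φ j := by
  intro n _
  simp_rw [← fastIter_succ_sub, Finset.sum_range_sub, fastIter, sub_zero]
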